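/- Let Q be an invertible n_u×n_u real matrix, A an n_y×n_u real matrix, n_o a positive natural number, and σ a nonzero real number. Let B be the (n_o·n_y)×n_u real matrix obtained by stacking n_o copies of A. Then (σ²)^{n_u} · det(BQ⁻¹Bᵀ + σ²I) · det(Q) = (σ²)^{n_o·n_y} · det(σ²Q + n_o·AᵀA), i.e. det(BQ⁻¹Bᵀ + σ²I) = (σ²)^{n_o·n_y − n_u} det(σ²Q + n_o·AᵀA) / det(Q). -/

import Mathlib

open Matrix

/-- A scaled form of the Weinstein–Aronszajn identity. -/
theorem Matrix.pow_card_mul_det_mul_add_smul_one {m n K : Type*} [Fintype m] [Fintype n]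
    [DecidableEq m] [DecidableEq n] [Field K] (U : Matrix m n K) (V : Matrix n m K)
    {c : K} (hc : c ≠ 0) :
    c ^ Fintype.card n * (U * V + c • (1 : Matrix m m K)).det =
      c ^ Fintype.card m * (V * U + c • (1 : Matrix n n K)).det := by
  have h₁ : U * V + c • (1 : Matrix m m K) = c • ((c⁻¹ • U) * V + 1) := by
    rw [smul_add, Matrix.smul_mul, smul_inv_smul₀ hc]
  have h₂ : V * U + c • (1 : Matrix n n K) = c • (V * (c⁻¹ • U) + 1) := by
    rw [smul_add, Matrix.mul_smul, smul_inv_smul₀ hc]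
  rw [h₁, h₂, det_smul, det_smul, det_mul_add_one_comm]
  ring

/-- The Gram matrix of `k` stacked copies of `A` is `k` times that of `A`. -/
theorem Matrix.transpose_mul_self_of_stacked {ι m n R : Type*} [Fintype ι] [Fintype m]
    [CommSemiring R] {A : Matrix m n R} {B : Matrix (ι × m) n R}
    (hB : ∀ i j k, B (i, j) k = A j k) :
    Bᵀ * B = (Fintype.card ι : R) • (Aᵀ * A) := by
  ext a b
  simp [Matrix.mul_apply, Fintype.sum_prod_type, hB]

/-- Determinant identity for repeated readings in GP regression: with `B` the
stacking of `n_o` copies of `A`,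
`(σ²)^{n_u} det(BQ⁻¹Bᵀ + σ²I) det(Q) = (σ²)^{n_o n_y} det(σ²Q + n_o AᵀA)`, i.e.
`det(BQ⁻¹Bᵀ + σ²I) = (σ²)^{n_o n_y − n_u} det(σ²Q + n_o AᵀA) / det(Q)`. -/
theorem gp_repeated_readings_det
    (nu ny no : ℕ) (hno : 0 < no)
    (Q : Matrix (Fin nu) (Fin nu) ℝ) (hQ : IsUnit Q.det)
    (A : Matrix (Fin ny) (Fin nu) ℝ) (σ : ℝ) (hσ : σ ≠ 0)
    (B : Matrix (Fin no × Fin ny) (Fin nu) ℝ)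
    (hB : ∀ (i : Fin no) (j : Fin ny) (k : Fin nu), B (i, j) k = A j k) :
    (σ ^ 2) ^ nu * (B * Q⁻¹ * Bᵀ
        + σ ^ 2 • (1 : Matrix (Fin no × Fin ny) (Fin no × Fin ny) ℝ)).det
        * Q.det =
      (σ ^ 2) ^ (no * ny) * (σ ^ 2 • Q + (no : ℝ) • (Aᵀ * A)).det ∧
    (B * Q⁻¹ * Bᵀ
        + σ ^ 2 • (1 : Matrix (Fin no × Fin ny) (Fin no × Fin ny) ℝ)).det =
      (σ ^ 2) ^ ((no * ny : ℤ) - (nu : ℤ))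
        * (σ ^ 2 • Q + (no : ℝ) • (Aᵀ * A)).det / Q.det := by
  have hc : σ ^ 2 ≠ 0 := pow_ne_zero 2 hσ
  have hgram : Bᵀ * B = (no : ℝ) • (Aᵀ * A) := by
    simpa using Matrix.transpose_mul_self_of_stacked hB
  have hfactor : Q * (Q⁻¹ * Bᵀ * B + σ ^ 2 • (1 : Matrix (Fin nu) (Fin nu) ℝ)) =
      σ ^ 2 • Q + (no : ℝ) • (Aᵀ * A) := by
    rw [Matrix.mul_add, Matrix.mul_assoc, mul_nonsing_inv_cancel_left _ _ hQ, hgram,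
      Matrix.mul_smul, Matrix.mul_one, add_comm]
  have hdet := Matrix.pow_card_mul_det_mul_add_smul_one B (Q⁻¹ * Bᵀ) hc
  simp only [Fintype.card_prod, Fintype.card_fin, ← Matrix.mul_assoc] at hdet
  have hmain : (σ ^ 2) ^ nu * (B * Q⁻¹ * Bᵀ
        + σ ^ 2 • (1 : Matrix (Fin no × Fin ny) (Fin no × Fin ny) ℝ)).det * Q.det =
      (σ ^ 2) ^ (no * ny) * (σ ^ 2 • Q + (no : ℝ) • (Aᵀ * A)).det := by
    rw [hdet, ← hfactor, det_mul]
    ring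
  refine ⟨hmain, ?_⟩
  have hpow : (σ ^ 2) ^ ((no * ny : ℤ) - (nu : ℤ)) =
      (σ ^ 2) ^ (no * ny) / (σ ^ 2) ^ nu := by
    rw [zpow_sub₀ hc, zpow_natCast]
    norm_cast
  rw [hpow, eq_div_iff hQ.ne_zero, div_mul_eq_mul_div, eq_div_iff (pow_ne_zero nu hc), ← hmain]
  ring
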